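/- None of the three functions ↓, Max, Card : ℙ → ℙ is (𝒰 ∪ 𝒫)-definable, where 𝒰 is the class of all uniformly continuous set-functions and 𝒫 the class of all predicates. -/

import Mathlib

noncomputable section
open Classical

/-- `s ⊕ t`: lifted addition on sets of naturals. -/
def setPlus (s t : Set ℕ) : Set ℕ := {u | ∃ m ∈ s, ∃ n ∈ t, u = m + n}

/-- `s ⊗ t`: lifted multiplication on sets of naturals. -/
def setTimes (s t : Set ℕ) : Set ℕ := {u | ∃ m ∈ s, ∃ n ∈ t, u = m * n}

/-- Sets of naturals definable by (variable-free) arithmetic circuits: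
the smallest collection containing `∅`, `ℕ`, all singletons, closed under
union, intersection, complement, `⊕` and `⊗`. -/
inductive ArithDefinable : Set ℕ → Prop
  | empty : ArithDefinable ∅
  | univ : ArithDefinable Set.univ
  | single (k : ℕ) : ArithDefinable {k}
  | union : ∀ {s t : Set ℕ}, ArithDefinable s → ArithDefinable t → ArithDefinable (s ∪ t)
  | inter : ∀ {s t : Set ℕ}, ArithDefinable s → ArithDefinable t → ArithDefinable (s ∩ t)
  | compl : ∀ {s : Set ℕ}, ArithDefinable s → ArithDefinable sᶜ
  | plus : ∀ {s t : Set ℕ}, ArithDefinable s → ArithDefinable t → ArithDefinable (setPlus s t)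
  | times : ∀ {s t : Set ℕ}, ArithDefinable s → ArithDefinable t → ArithDefinable (setTimes s t)

/-- A set-function of arity `k`. -/
abbrev SetFun (k : ℕ) := (Fin k → Set ℕ) → Set ℕ

/-- The `𝒪`-definable functions `ℙ^n → ℙ`, for a collection `O` of set-functions
(given per arity): smallest class containing projections and the constants
`∅`, `ℕ`, `{k}`, closed under pointwise union, intersection, complement, and
composition with functions in `O`. -/
inductive ODef (O : ∀ k, Set (SetFun k)) (n : ℕ) : SetFun n → Prop
  | proj (i : Fin n) : ODef O n (fun s => s i)
  | empty : ODef O n (fun _ => ∅)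
  | univ : ODef O n (fun _ => Set.univ)
  | single (k : ℕ) : ODef O n (fun _ => {k})
  | union : ∀ {F G : SetFun n}, ODef O n F → ODef O n G → ODef O n (fun s => F s ∪ G s)
  | inter : ∀ {F G : SetFun n}, ODef O n F → ODef O n G → ODef O n (fun s => F s ∩ G s)
  | compl : ∀ {F : SetFun n}, ODef O n F → ODef O n (fun s => (F s)ᶜ)
  | comp : ∀ {k : ℕ} {g : SetFun k} {F : Fin k → SetFun n},
      g ∈ O k → (∀ i, ODef O n (F i)) → ODef O n (fun s => g (fun i => F i s))

/-- `s_{|m} = s ∩ {0,…,m}`. -/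
def restrict (s : Set ℕ) (m : ℕ) : Set ℕ := s ∩ {k | k ≤ m}

/-- `F` is `h`-continuous on `D`. -/
def HCont (h : ℕ → ℕ) {n : ℕ} (F : SetFun n) (D : Set (Fin n → Set ℕ)) : Prop :=
  ∀ m : ℕ, ∀ s ∈ D, ∀ t ∈ D,
    (∀ i, restrict (s i) (h m) = restrict (t i) (h m)) →
    restrict (F s) m = restrict (F t) m

/-- `F` is uniformly continuous on `D`. -/
def UnifCont {n : ℕ} (F : SetFun n) (D : Set (Fin n → Set ℕ)) : Prop :=
  ∃ h : ℕ → ℕ, HCont h F D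

/-- `𝒰`: set-functions (of arity `k`) uniformly continuous on the whole space. -/
def Ucal (k : ℕ) : Set (SetFun k) := {g | UnifCont g Set.univ}

/-- `𝒫`: predicates, i.e. set-functions with values among `∅` and `{0}`. -/
def Pcal (k : ℕ) : Set (SetFun k) := {g | ∀ s, g s = ∅ ∨ g s = {0}}

/-- `𝒰 ∪ 𝒫`. -/
def UPcal (k : ℕ) : Set (SetFun k) := Ucal k ∪ Pcal k

/-- `Max(x)`. -/
def MaxFun (x : Set ℕ) : Set ℕ :=
  if x = ∅ then ∅ else if x.Infinite then Set.univ else {sSup x}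

/-- `Card(x)`. -/
def CardFun (x : Set ℕ) : Set ℕ := if x.Finite then {x.ncard} else Set.univ

/-- `↓(x)`. -/
def DownFun (x : Set ℕ) : Set ℕ := {m | ∃ n ∈ x, m ≤ n}

/-- `Sum(x)`. -/
def SumFun (x : Set ℕ) : Set ℕ := if x.Finite then {∑ᶠ n ∈ x, n} else Set.univ

/-- `Prod(x)`. -/
def ProdFun (x : Set ℕ) : Set ℕ := if x.Finite then {∏ᶠ n ∈ x, n} else Set.univ

/-- `Shove(x) = {n - min x : n ∈ x}` (empty for `x = ∅`). -/
def ShoveFun (x : Set ℕ) : Set ℕ := (fun n => n - sInf x) '' x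

/-- `ε(x)`: the test for emptiness. -/
def epsFun (x : Set ℕ) : Set ℕ := if x = ∅ then {0} else ∅

/-- `Fin(x)`: the test for finiteness. -/
def FinFun (x : Set ℕ) : Set ℕ := if x.Finite then {0} else ∅

/-- `⊕` as a set-function of arity 2. -/
def plusFun : SetFun 2 := fun s => setPlus (s 0) (s 1)

/-- `⊗` as a set-function of arity 2. -/
def timesFun : SetFun 2 := fun s => setTimes (s 0) (s 1)

/-- `↓` as a set-function of arity 1. -/
def downFun1 : SetFun 1 := fun s => DownFun (s 0)

/-- `ε` as a set-function of arity 1. -/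
def epsFun1 : SetFun 1 := fun s => epsFun (s 0)

/-- The collection `{⊕, ⊗}`. -/
def arithO : ∀ k, Set (SetFun k)
  | 2 => {plusFun, timesFun}
  | _ => ∅

/-- The collection `{⊕}`. -/
def addO : ∀ k, Set (SetFun k)
  | 2 => {plusFun}
  | _ => ∅

/-- The collection `{⊕, ↓} ∪ 𝒫`. -/
def addDownO : ∀ k, Set (SetFun k)
  | 1 => insert downFun1 (Pcal 1)
  | 2 => insert plusFun (Pcal 2)
  | k => Pcal k

/-- The collection `{⊕, ⊗, ↓} ∪ 𝒫`. -/
def arithDownO : ∀ k, Set (SetFun k)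
  | 1 => insert downFun1 (Pcal 1)
  | 2 => {plusFun, timesFun} ∪ Pcal 2
  | k => Pcal k

/-- The collection `𝒰 ∪ {ε}`. -/
def UEps : ∀ k, Set (SetFun k)
  | 1 => insert epsFun1 (Ucal 1)
  | k => Ucal k

/-- The collection `{⊕, ⊗} ∪ 𝒫`. -/
def arithPO (k : ℕ) : Set (SetFun k) := arithO k ∪ Pcal k

/-- A numerical function `ℕ → ℕ` is `O`-definable if some `O`-definable
set-function maps `{m}` to `{f m}` for every `m`. -/
def NumDef1 (O : ∀ k, Set (SetFun k)) (f : ℕ → ℕ) : Prop :=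
  ∃ F : SetFun 1, ODef O 1 F ∧ ∀ m : ℕ, F (fun _ => {m}) = {f m}

/-- A numerical function `ℕ^k → ℕ` is `O`-definable if some `O`-definable
set-function maps tuples of singletons to the corresponding singleton value. -/
def NumDef (O : ∀ k, Set (SetFun k)) (k : ℕ) (f : (Fin k → ℕ) → ℕ) : Prop :=
  ∃ F : SetFun k, ODef O k F ∧ ∀ m : Fin k → ℕ, F (fun i => ({m i} : Set ℕ)) = {f m}

/-- `f` is regressive: `{f n : f n < n}` is infinite. -/
def Regressive (f : ℕ → ℕ) : Prop := {y | ∃ n, f n = y ∧ y < n}.Infinite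

/-- `f` is semi-regressive: for every `ℓ` there is `n` with `n + ℓ ≤ f n ≤ 2n - 2`. -/
def SemiRegressive (f : ℕ → ℕ) : Prop :=
  ∀ ℓ : ℕ, ∃ n : ℕ, n + ℓ ≤ f n ∧ (f n : ℤ) ≤ 2 * (n : ℤ) - 2

theorem mem_iff_of_restrict_eq {s t : Set ℕ} {m k : ℕ} (h : restrict s m = restrict t m)
    (hk : k ≤ m) : k ∈ s ↔ k ∈ t := by
  have := congrArg (k ∈ ·) h
  simpa [restrict, hk] using this

theorem restrict_eq_of_mem_iff {s t : Set ℕ} {m : ℕ} (h : ∀ k ≤ m, (k ∈ s ↔ k ∈ t)) :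
    restrict s m = restrict t m := by
  ext k
  simp only [restrict, Set.mem_inter_iff, Set.mem_ofPred_eq]
  exact and_congr_left (h k)

theorem restrict_eq_of_le {s t : Set ℕ} {m n : ℕ} (hmn : m ≤ n)
    (h : restrict s n = restrict t n) : restrict s m = restrict t m :=
  restrict_eq_of_mem_iff fun _ hk => mem_iff_of_restrict_eq h (hk.trans hmn)

/-- `F` is `h`-continuous, for a common `h`, on each piece of some finite partition of the
space. -/
def PiecewiseUnifCont {n : ℕ} (F : SetFun n) : Prop :=
  ∃ (C : Type) (_ : Finite C) (c : (Fin n → Set ℕ) → C) (h : ℕ → ℕ),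
    ∀ d, HCont h F {s | c s = d}

theorem UnifCont.piecewiseUnifCont {n : ℕ} {F : SetFun n} (hF : UnifCont F Set.univ) :
    PiecewiseUnifCont F := by
  obtain ⟨h, hh⟩ := hF
  exact ⟨Unit, inferInstance, fun _ => (), h,
    fun _ m s _ t _ hst => hh m s trivial t trivial hst⟩

theorem PiecewiseUnifCont.comp {n k : ℕ} {g : SetFun k} {F : Fin k → SetFun n}
    (hg : UnifCont g Set.univ) (hF : ∀ i, PiecewiseUnifCont (F i)) :
    PiecewiseUnifCont (fun s => g (fun i => F i s)) := by
  obtain ⟨hg, hhg⟩ := hg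
  choose C hC c h hh using hF
  refine ⟨∀ i, C i, inferInstance, fun s i => c i s,
    fun m => Finset.univ.sup fun i => h i (hg m), ?_⟩
  intro d m s hs t ht hst
  refine hhg m _ trivial _ trivial fun i => ?_
  refine hh i (d i) (hg m) s (congrFun hs i) t (congrFun ht i) fun j => ?_
  exact restrict_eq_of_le (Finset.le_sup (f := fun i => h i (hg m)) (Finset.mem_univ i)) (hst j)

theorem PiecewiseUnifCont.of_predicate {n : ℕ} {F : SetFun n} (hF : F ∈ Pcal n) :
    PiecewiseUnifCont F := by
  refine ⟨Prop, inferInstance, fun s => F s = ∅, id, ?_⟩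
  intro d m s hs t ht _
  have hst : F s = ∅ ↔ F t = ∅ := iff_of_eq (hs.trans ht.symm)
  have : F s = F t := by
    rcases hF s with h | h <;> rcases hF t with h' | h' <;> simp_all
  rw [this]

theorem unifCont_of_pointwise {n : ℕ} {F : SetFun n}
    (hF : ∀ s t k, (∀ i, k ∈ s i ↔ k ∈ t i) → (k ∈ F s ↔ k ∈ F t)) :
    UnifCont F Set.univ :=
  ⟨id, fun _ _ _ _ _ hst => restrict_eq_of_mem_iff fun k hk =>
    hF _ _ k fun i => mem_iff_of_restrict_eq (hst i) hk⟩

theorem ODef.piecewiseUnifCont {n : ℕ} {F : SetFun n} (hF : ODef UPcal n F) :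
    PiecewiseUnifCont F := by
  induction hF with
  | proj i => exact (unifCont_of_pointwise fun _ _ _ h => h i).piecewiseUnifCont
  | empty => exact (unifCont_of_pointwise fun _ _ _ _ => Iff.rfl).piecewiseUnifCont
  | univ => exact (unifCont_of_pointwise fun _ _ _ _ => Iff.rfl).piecewiseUnifCont
  | single k => exact (unifCont_of_pointwise fun _ _ _ _ => Iff.rfl).piecewiseUnifCont
  | @union F G _ _ hF hG =>
    exact PiecewiseUnifCont.comp (g := fun s : Fin 2 → Set ℕ => s 0 ∪ s 1) (F := ![F, G])
      (unifCont_of_pointwise fun _ _ _ h => or_congr (h 0) (h 1))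
      (Fin.forall_fin_two.2 ⟨hF, hG⟩)
  | @inter F G _ _ hF hG =>
    exact PiecewiseUnifCont.comp (g := fun s : Fin 2 → Set ℕ => s 0 ∩ s 1) (F := ![F, G])
      (unifCont_of_pointwise fun _ _ _ h => and_congr (h 0) (h 1))
      (Fin.forall_fin_two.2 ⟨hF, hG⟩)
  | @compl F _ hF =>
    exact PiecewiseUnifCont.comp (g := fun s : Fin 1 → Set ℕ => (s 0)ᶜ) (F := fun _ => F)
      (unifCont_of_pointwise fun _ _ _ h => not_congr (h 0)) fun _ => hF
  | comp hg _ ih =>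
    rcases hg with hg | hg
    · exact PiecewiseUnifCont.comp hg ih
    · exact PiecewiseUnifCont.of_predicate fun s => hg _

/-- A sparse increasing sequence has two initial segments that a piecewise uniformly continuous
function fails to separate just beyond the maximum of the smaller one. -/
theorem PiecewiseUnifCont.exists_initial_segments {f : Set ℕ → Set ℕ}
    (hf : PiecewiseUnifCont (n := 1) fun s => f (s 0)) :
    ∃ a : ℕ → ℕ, StrictMono a ∧ ∃ i j, i < j ∧ ∀ k ≤ a i + 1,
      (k ∈ f (a '' Set.Iic i) ↔ k ∈ f (a '' Set.Iic j)) := by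
  obtain ⟨C, _, c, h, hh⟩ := hf
  let a : ℕ → ℕ := fun i => Nat.rec 0 (fun _ x => max (h (x + 1)) x + 1) i
  have ha (i : ℕ) : a (i + 1) = max (h (a i + 1)) (a i) + 1 := rfl
  have hmono : StrictMono a := strictMono_nat_of_lt_succ fun i => by rw [ha]; omega
  obtain ⟨i, j, hij, hc⟩ : ∃ i j, i < j ∧
      c (fun _ => a '' Set.Iic i) = c (fun _ => a '' Set.Iic j) := by
    obtain ⟨i, j, hne, hc⟩ :=
      Finite.exists_ne_map_eq_of_infinite fun i => c (fun _ => a '' Set.Iic i)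
    rcases hne.lt_or_gt with hlt | hlt
    · exact ⟨i, j, hlt, hc⟩
    · exact ⟨j, i, hlt, hc.symm⟩
  refine ⟨a, hmono, i, j, hij, fun k hk => ?_⟩
  refine mem_iff_of_restrict_eq (hh _ (a i + 1) _ hc _ rfl fun _ => ?_) hk
  refine restrict_eq_of_mem_iff fun k hk => ⟨?_, ?_⟩
  · rintro ⟨l, hl, rfl⟩
    exact ⟨l, le_trans hl hij.le, rfl⟩
  · rintro ⟨l, -, rfl⟩
    refine ⟨l, ?_, rfl⟩
    by_contra hl
    have := hmono.monotone (Nat.succ_le_of_lt (not_le.1 hl))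
    rw [Nat.succ_eq_add_one, ha] at this
    omega

theorem maxFun_image_Iic {a : ℕ → ℕ} (ha : StrictMono a) (i : ℕ) :
    MaxFun (a '' Set.Iic i) = {a i} := by
  have hg : IsGreatest (a '' Set.Iic i) (a i) :=
    ⟨⟨i, Set.self_mem_Iic, rfl⟩, by rintro _ ⟨l, hl, rfl⟩; exact ha.monotone hl⟩
  have hfin : (a '' Set.Iic i).Finite := (Set.finite_Iic i).image a
  rw [MaxFun, if_neg hg.nonempty.ne_empty, if_neg hfin.not_infinite, hg.csSup_eq]

theorem cardFun_image_Iic {a : ℕ → ℕ} (ha : StrictMono a) (i : ℕ) :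
    CardFun (a '' Set.Iic i) = {i + 1} := by
  rw [CardFun, if_pos ((Set.finite_Iic i).image a), Set.ncard_image_of_injective _ ha.injective,
    ← Finset.coe_Iic, Set.ncard_coe_finset, Nat.card_Iic]

theorem down_max_card_not_UP_definable :
    ¬ ODef UPcal 1 (fun s => DownFun (s 0)) ∧
    ¬ ODef UPcal 1 (fun s => MaxFun (s 0)) ∧
    ¬ ODef UPcal 1 (fun s => CardFun (s 0)) := by
  refine ⟨fun hF => ?_, fun hF => ?_, fun hF => ?_⟩ <;>
    obtain ⟨a, ha, i, j, hij, h⟩ := hF.piecewiseUnifCont.exists_initial_segments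
  · obtain ⟨_, ⟨l, hl, rfl⟩, hlt⟩ := (h (a i + 1) le_rfl).2
      ⟨a j, ⟨j, Set.self_mem_Iic, rfl⟩, ha hij⟩
    have := ha.monotone hl
    omega
  · have := h (a i) (Nat.le_succ _)
    rw [maxFun_image_Iic ha, maxFun_image_Iic ha] at this
    exact (ha hij).ne (this.1 rfl)
  · have := h (i + 1) (Nat.succ_le_succ ha.le_apply)
    rw [cardFun_image_Iic ha, cardFun_image_Iic ha] at this
    have : i + 1 = j + 1 := this.1 rfl
    omega

end
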